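/- arXiv:2504.17868 — 2 statements merged into one kernel-verified Lean document; each statement's English description precedes it below -/
import Mathlib

section
/- For every integer Δ ≥ 0 and integer q ≥ 2, there exists a rooted tree T with a partial edge coloring such that: (a) for every leaf v of T there is a color c_v such that v is the unique leaf of minimal depth among the leaves that remain connected to the root after deleting all edges of color c_v; (b) every color appears on at most Δ edges of T; (c) T has exactly q^Δ leaves; (d) every leaf has depth at least q^Δ − 1 and at most 2(q^Δ − 1); (e) T has exactly Δ·(q^{Δ+1} − q^{Δ−1}) edges. -/
/-- A finite rooted tree with a partial edge coloring: `col v` is the color (if any) of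
the edge joining `v` to its parent, for `v ≠ root`. -/
structure RCTree (C : Type) where
  V : Type
  fin : Fintype V
  root : V
  parent : V → V
  depth : V → ℕ
  col : V → Option C
  parent_root : parent root = root
  depth_root : depth root = 0
  depth_eq_zero : ∀ v, depth v = 0 → v = root
  depth_parent : ∀ v, v ≠ root → depth (parent v) + 1 = depth v

namespace RCTree

variable {C : Type} (T : RCTree C)

/-- A leaf: a vertex with no children. -/
def IsLeaf (v : T.V) : Prop := ∀ u : T.V, u ≠ T.root → T.parent u ≠ v

/-- `v` remains connected to the root after deleting all edges of color `c`:
no edge on the root-to-`v` path has color `c`. -/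
def Survives (c : C) (v : T.V) : Prop :=
  ∀ k : ℕ, k < T.depth v → T.col (T.parent^[k] v) ≠ some c

end RCTree

/-- Terms for rooted trees with a partial edge coloring by natural numbers and labelled leaves:
a single vertex, a tree hung below a new root by one edge, and two trees glued at their roots. -/
inductive TreeTerm where
  | leaf (label : ℕ)
  | edge (c : Option ℕ) (t : TreeTerm)
  | join (s t : TreeTerm)

namespace TreeTerm

/-- The non-root vertices. -/
def Node : TreeTerm → Type
  | leaf _ => Empty
  | edge _ t => Option (Node t)
  | join s t => Node s ⊕ Node t

instance instFintypeNode : ∀ t : TreeTerm, Fintype (Node t)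
  | leaf _ => inferInstanceAs (Fintype Empty)
  | edge _ t =>
    haveI := instFintypeNode t
    inferInstanceAs (Fintype (Option (Node t)))
  | join s t =>
    haveI := instFintypeNode s
    haveI := instFintypeNode t
    inferInstanceAs (Fintype (Node s ⊕ Node t))

/-- The parent of a non-root vertex, where `none` stands for the root. -/
def parent : ∀ t : TreeTerm, Node t → Option (Node t)
  | leaf _ => fun x => Empty.elim x
  | edge _ t => fun x : Option (Node t) => x.map (parent t)
  | join s t => Sum.elim (fun x => (parent s x).map Sum.inl) (fun x => (parent t x).map Sum.inr)

/-- The color of the edge joining a non-root vertex to its parent. -/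
def color : ∀ t : TreeTerm, Node t → Option ℕ
  | leaf _ => fun x => Empty.elim x
  | edge c t => fun x : Option (Node t) => x.elim c (color t)
  | join s t => Sum.elim (color s) (color t)

/-- The colors along the path from the root to a vertex. -/
def trace : ∀ t : TreeTerm, Option (Node t) → List (Option ℕ)
  | leaf _ => fun _ => []
  | edge c t => fun x : Option (Option (Node t)) => x.elim [] fun y => c :: trace t y
  | join s t => fun x : Option (Node s ⊕ Node t) =>
      x.elim [] (Sum.elim (fun y => trace s (some y)) (fun y => trace t (some y)))

/-- The colors of all edges. -/
def colors : TreeTerm → List (Option ℕ)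
  | leaf _ => []
  | edge c t => c :: colors t
  | join s t => colors s ++ colors t

/-- The leaves together with their labels. -/
def labelledLeaves : ∀ t : TreeTerm, List (ℕ × Option (Node t))
  | leaf a => [(a, none)]
  | edge _ t => (labelledLeaves t).map fun x => (x.1, some x.2)
  | join s t => (labelledLeaves s).map (fun x => (x.1, x.2.map Sum.inl)) ++
      (labelledLeaves t).map (fun x => (x.1, x.2.map Sum.inr))

/-- Only trees with at least one edge are glued. -/
def WellFormed : TreeTerm → Prop
  | leaf _ => True
  | edge _ t => WellFormed t
  | join s t => ((∃ x, parent s x = none) ∧ WellFormed s) ∧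
      ((∃ x, parent t x = none) ∧ WellFormed t)

@[simp] lemma trace_none (t : TreeTerm) : trace t none = [] := by
  cases t <;> rfl

/-- The label of each leaf and the colors on the path leading to it. -/
def leafTraces (t : TreeTerm) : List (ℕ × List (Option ℕ)) :=
  (labelledLeaves t).map fun x => (x.1, trace t x.2)

lemma leafTraces_leaf (a : ℕ) : leafTraces (leaf a) = [(a, [])] := rfl

lemma leafTraces_edge (c : Option ℕ) (t : TreeTerm) :
    leafTraces (edge c t) = (leafTraces t).map fun x => (x.1, c :: x.2) := by
  simp only [leafTraces, labelledLeaves, List.map_map]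
  rfl

lemma leafTraces_join (s t : TreeTerm) :
    leafTraces (join s t) = leafTraces s ++ leafTraces t := by
  refine List.map_append.trans (congrArg₂ (· ++ ·) ?_ ?_) <;>
  · refine List.map_map.trans (List.map_congr_left fun x _ => ?_)
    rcases x with ⟨a, _ | y⟩
    · exact congrArg (Prod.mk a) ((trace_none _).trans (trace_none _).symm)
    · rfl

lemma trace_some (t : TreeTerm) (x : Node t) :
    trace t (some x) = trace t (parent t x) ++ [color t x] := by
  induction t with
  | leaf a => exact Empty.elim x
  | edge c t ih =>
    rcases x with _ | x
    · change c :: trace t none = [c]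
      rw [trace_none]
    · change c :: trace t (some x) = (c :: trace t (parent t x)) ++ [color t x]
      rw [ih, List.cons_append]
  | join s t ihs iht =>
    rcases x with x | x
    · change trace s (some x) =
        trace (join s t) ((parent s x).map Sum.inl) ++ [color s x]
      rw [ihs]
      cases parent s x with
      | none => rw [trace_none]; rfl
      | some y => rfl
    · change trace t (some x) =
        trace (join s t) ((parent t x).map Sum.inr) ++ [color t x]
      rw [iht]
      cases parent t x with
      | none => rw [trace_none]; rfl
      | some y => rfl

lemma sum_color (t : TreeTerm) (f : Option ℕ → ℕ) :
    ∑ x : Node t, f (color t x) = ((colors t).map f).sum := by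
  induction t with
  | leaf a => rfl
  | edge c t ih =>
    rw [colors, List.map_cons, List.sum_cons, ← ih]
    exact Fintype.sum_option fun x : Option (Node t) => f (color (edge c t) x)
  | join s t ihs iht =>
    rw [colors, List.map_append, List.sum_append, ← ihs, ← iht]
    exact Fintype.sum_sum_type fun x : Node s ⊕ Node t => f (color (join s t) x)

lemma card_node (t : TreeTerm) : Fintype.card (Node t) = (colors t).length := by
  simpa using sum_color t fun _ => 1

lemma ncard_color_eq (t : TreeTerm) (c : Option ℕ) :
    {x : Node t | color t x = c}.ncard = (colors t).count c := by
  classical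
  have h := sum_color t fun a => if a = c then 1 else 0
  rw [← Finset.card_filter] at h
  rw [Set.ncard_eq_toFinset_card', Set.toFinset_ofPred, h]
  induction colors t with
  | nil => rfl
  | cons a l ih =>
    simp only [List.map_cons, List.sum_cons, ih, List.count_cons, beq_iff_eq]
    omega

lemma mem_labelledLeaves_edge {c : Option ℕ} {t : TreeTerm} {a : ℕ}
    {v : Option (Option (Node t))} :
    (a, v) ∈ labelledLeaves (edge c t) ↔ ∃ w, (a, w) ∈ labelledLeaves t ∧ some w = v := by
  refine List.mem_map.trans ⟨?_, ?_⟩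
  · rintro ⟨⟨a', w⟩, h, heq⟩
    obtain ⟨rfl, h2⟩ := Prod.mk.inj heq
    exact ⟨w, h, h2⟩
  · rintro ⟨w, h, rfl⟩
    exact ⟨(a, w), h, rfl⟩

lemma mem_labelledLeaves_join {s t : TreeTerm} {a : ℕ} {v : Option (Node s ⊕ Node t)} :
    (a, v) ∈ labelledLeaves (join s t) ↔
      (∃ w, (a, w) ∈ labelledLeaves s ∧ w.map Sum.inl = v) ∨
        ∃ w, (a, w) ∈ labelledLeaves t ∧ w.map Sum.inr = v := by
  refine List.mem_append.trans (or_congr ?_ ?_) <;>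
  · refine List.mem_map.trans ⟨?_, ?_⟩
    · rintro ⟨⟨a', w⟩, h, heq⟩
      obtain ⟨rfl, h2⟩ := Prod.mk.inj heq
      exact ⟨w, h, h2⟩
    · rintro ⟨w, h, rfl⟩
      exact ⟨(a, w), h, rfl⟩

lemma exists_mem_labelledLeaves_iff {t : TreeTerm} (ht : t.WellFormed) (v : Option (Node t)) :
    (∃ a, (a, v) ∈ labelledLeaves t) ↔ ∀ x, parent t x ≠ v := by
  induction t with
  | leaf a =>
    rcases v with _ | v
    · exact ⟨fun _ x => Empty.elim x, fun _ => ⟨a, List.mem_singleton.2 rfl⟩⟩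
    · exact Empty.elim v
  | edge c t ih =>
    change Option (Option (Node t)) at v
    have h : (∀ x : Node (edge c t), parent (edge c t) x ≠ v) ↔
        ∀ x : Option (Node t), x.map (parent t) ≠ v := Iff.rfl
    refine (exists_congr fun a => mem_labelledLeaves_edge).trans (Iff.trans ?_ h.symm)
    rcases v with _ | v
    · simp
    · simpa [Option.forall] using ih ht v
  | join s t ihs iht =>
    obtain ⟨⟨⟨x, hx⟩, hs⟩, ⟨y, hy⟩, ht⟩ := ht
    change Option (Node s ⊕ Node t) at v
    have h : (∀ x : Node (join s t), parent (join s t) x ≠ v) ↔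
        (∀ x, (parent s x).map Sum.inl ≠ v) ∧ ∀ x, (parent t x).map Sum.inr ≠ v :=
      Sum.forall
    refine (exists_congr fun a => mem_labelledLeaves_join).trans (Iff.trans ?_ h.symm)
    have hs' := ihs hs
    have ht' := iht ht
    rcases v with _ | v | v
    · refine iff_of_false ?_ fun h => h.1 x (by rw [hx]; rfl)
      rintro ⟨a, ⟨w, h, hw⟩ | ⟨w, h, hw⟩⟩
      · rw [Option.map_eq_none_iff.1 hw] at h
        exact (hs' _).1 ⟨a, h⟩ x hx
      · rw [Option.map_eq_none_iff.1 hw] at h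
        exact (ht' _).1 ⟨a, h⟩ y hy
    · simpa using hs' (some v)
    · simpa using ht' (some v)

/-- The rooted tree described by a term. -/
def toRCTree (t : TreeTerm) : RCTree ℕ where
  V := Option (Node t)
  fin := inferInstance
  root := none
  parent v := v.bind (parent t)
  depth v := (trace t v).length
  col v := v.bind (color t)
  parent_root := rfl
  depth_root := by simp
  depth_eq_zero v hv := by
    cases v with
    | none => rfl
    | some x => simp [trace_some] at hv
  depth_parent v hv := by
    cases v with
    | none => exact absurd rfl hv
    | some x => simp [trace_some]

lemma survives_iff (t : TreeTerm) (c : ℕ) (v : Option (Node t)) :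
    t.toRCTree.Survives c v ↔ some c ∉ trace t v := by
  induction h : (trace t v).length generalizing v with
  | zero =>
    have : trace t v = [] := List.length_eq_zero_iff.1 h
    refine iff_of_true (fun k hk => ?_) (by simp [this])
    exact absurd (hk.trans_eq h) (Nat.not_lt_zero k)
  | succ n ih =>
    cases v with
    | none => simp at h
    | some x =>
      have hn : (trace t (parent t x)).length = n := by simpa [trace_some] using h
      have key : t.toRCTree.Survives c (some x) ↔
          color t x ≠ some c ∧ t.toRCTree.Survives c (parent t x) := by
        constructor
        · intro hs
          refine ⟨hs 0 (by change 0 < (trace t (some x)).length; omega), fun k hk => ?_⟩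
          refine hs (k + 1) ?_
          change k < (trace t (parent t x)).length at hk
          change k + 1 < (trace t (some x)).length
          omega
        · rintro ⟨h0, hs⟩ (_ | k) hk
          · exact h0
          · refine hs k ?_
            change k + 1 < (trace t (some x)).length at hk
            change k < (trace t (parent t x)).length
            omega
      rw [key, ih _ hn, trace_some]
      simp only [List.mem_append, List.mem_singleton, not_or]
      rw [and_comm, ne_comm]

lemma isLeaf_iff {t : TreeTerm} (ht : t.WellFormed) (v : Option (Node t)) :
    t.toRCTree.IsLeaf v ↔ ∃ a, (a, v) ∈ labelledLeaves t := by
  rw [exists_mem_labelledLeaves_iff ht]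
  constructor
  · intro h x
    exact h (some x) (Option.some_ne_none x)
  · rintro h (_ | x) hu
    · exact absurd rfl hu
    · exact h x

/-- Hang a tree below a path with prescribed edge colors. -/
def hang (l : List (Option ℕ)) (t : TreeTerm) : TreeTerm := l.foldr edge t

lemma colors_hang (l : List (Option ℕ)) (t : TreeTerm) : (hang l t).colors = l ++ t.colors := by
  induction l with
  | nil => rfl
  | cons c l ih => exact congrArg (c :: ·) ih

lemma leafTraces_hang (l : List (Option ℕ)) (t : TreeTerm) :
    leafTraces (hang l t) = (leafTraces t).map fun x => (x.1, l ++ x.2) := by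
  induction l with
  | nil => simp [hang]
  | cons c l ih =>
    change leafTraces (edge c (hang l t)) = _
    rw [leafTraces_edge, ih, List.map_map]
    rfl

lemma WellFormed.hang {t : TreeTerm} (ht : t.WellFormed) (l : List (Option ℕ)) :
    (hang l t).WellFormed := by
  induction l with
  | nil => exact ht
  | cons c l ih => exact ih

lemma exists_parent_hang {l : List (Option ℕ)} (hl : l ≠ []) (t : TreeTerm) :
    ∃ x, parent (hang l t) x = none := by
  cases l with
  | nil => exact absurd rfl hl
  | cons c l => exact ⟨(none : Option (Node (hang l t))), rfl⟩

/-- A tree with `N` leaves, listed by increasing depth and labelled by colors in `[b, b + N)`,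
such that deleting the label of a leaf keeps that leaf and disconnects all earlier ones; each
color is used at most `D` times, and there are `E` edges. -/
structure Separating (b N D E : ℕ) (t : TreeTerm) : Prop where
  wellFormed : t.WellFormed
  length_leafTraces : t.leafTraces.length = N
  pairwise : t.leafTraces.Pairwise fun x y => x.2.length < y.2.length ∧ some y.1 ∈ x.2
  label_mem : ∀ x ∈ t.leafTraces, b ≤ x.1 ∧ x.1 < b + N
  depth_mem : ∀ x ∈ t.leafTraces, N ≤ x.2.length + 1 ∧ x.2.length + 2 ≤ 2 * N
  label_notMem : ∀ x ∈ t.leafTraces, some x.1 ∉ x.2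
  count_le : ∀ c, t.colors.count (some c) ≤ D
  count_eq_zero : ∀ c, ¬ (b ≤ c ∧ c < b + N) → t.colors.count (some c) = 0
  length_colors : t.colors.length = E

lemma separating_leaf (b : ℕ) : Separating b 1 0 0 (leaf b) := by
  constructor <;> simp [leafTraces_leaf, colors, WellFormed]

lemma Separating.mono {b N D D' E : ℕ} {t : TreeTerm} (h : Separating b N D E t) (hD : D ≤ D') :
    Separating b N D' E t :=
  { h with count_le := fun c => (h.count_le c).trans hD }

lemma count_map_some_range' (b n c : ℕ) :
    ((List.range' b n).map some).count (some c) = if b ≤ c ∧ c < b + n then 1 else 0 := by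
  rw [List.count_map_of_injective _ _ (Option.some_injective ℕ)]
  split_ifs with h
  · exact List.count_eq_one_of_mem List.nodup_range' (List.mem_range'_1.2 h)
  · exact List.count_eq_zero_of_not_mem (mt List.mem_range'_1.1 h)

lemma Separating.glue {b N n D E F : ℕ} {s t : TreeTerm} (hs : Separating b N (D + 1) E s)
    (ht : Separating (b + N) n D F t) (hN : 0 < N) (hn : 0 < n) :
    Separating b (N + n) (D + 1) (E + F + n + 2 * N)
      (join (hang ((List.range' (b + N) n).map some) s)
        (hang (List.replicate (2 * N) none) t)) := by
  have hl1 : (List.range' (b + N) n).map some ≠ [] := by simp; omega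
  have hl2 : (List.replicate (2 * N) none : List (Option ℕ)) ≠ [] := by simp; omega
  have hc : ∀ c, (join (hang ((List.range' (b + N) n).map some) s)
        (hang (List.replicate (2 * N) none) t)).colors.count (some c) =
      (if b + N ≤ c ∧ c < b + N + n then 1 else 0) + s.colors.count (some c) +
        t.colors.count (some c) := by
    intro c
    simp only [colors, colors_hang, List.count_append, count_map_some_range']
    simp [List.count_replicate]
  refine ⟨⟨⟨exists_parent_hang hl1 s, hs.wellFormed.hang _⟩,
    exists_parent_hang hl2 t, ht.wellFormed.hang _⟩, ?_, ?_, ?_, ?_, ?_, ?_, ?_, ?_⟩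
  · simp [leafTraces_join, leafTraces_hang, hs.length_leafTraces, ht.length_leafTraces]
  · rw [leafTraces_join, leafTraces_hang, leafTraces_hang, List.pairwise_append]
    refine ⟨?_, ?_, ?_⟩
    · rw [List.pairwise_map]
      refine hs.pairwise.imp fun h => ⟨by simpa using h.1, List.mem_append_right _ h.2⟩
    · rw [List.pairwise_map]
      refine ht.pairwise.imp fun h => ⟨by simpa using h.1, List.mem_append_right _ h.2⟩
    · simp only [List.mem_map]
      rintro _ ⟨x, hx, rfl⟩ _ ⟨y, hy, rfl⟩
      have h1 := hs.depth_mem x hx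
      have h2 := ht.depth_mem y hy
      have h3 := ht.label_mem y hy
      refine ⟨by simp; omega, List.mem_append_left _ ?_⟩
      exact List.mem_map_of_mem (List.mem_range'_1.2 h3)
  · simp only [leafTraces_join, leafTraces_hang, List.mem_append, List.mem_map]
    rintro _ (⟨x, hx, rfl⟩ | ⟨x, hx, rfl⟩)
    · have := hs.label_mem x hx
      dsimp only
      omega
    · have := ht.label_mem x hx
      dsimp only
      omega
  · simp only [leafTraces_join, leafTraces_hang, List.mem_append, List.mem_map]
    rintro _ (⟨x, hx, rfl⟩ | ⟨x, hx, rfl⟩)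
    · have := hs.depth_mem x hx
      simp
      omega
    · have := ht.depth_mem x hx
      simp
      omega
  · simp only [leafTraces_join, leafTraces_hang, List.mem_append, List.mem_map]
    rintro _ (⟨x, hx, rfl⟩ | ⟨x, hx, rfl⟩)
    · have := hs.label_mem x hx
      have h : ¬ (b + N ≤ x.1 ∧ x.1 < b + N + n) := by omega
      simp [hs.label_notMem x hx, h]
    · have := ht.label_notMem x hx
      simp [this]
  · intro c
    have h1 := hs.count_le c
    have h2 := ht.count_le c
    have h3 := hs.count_eq_zero c
    have h4 := ht.count_eq_zero c
    rw [hc]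
    split_ifs <;> omega
  · intro c h
    have h3 := hs.count_eq_zero c
    have h4 := ht.count_eq_zero c
    rw [hc]
    split_ifs <;> omega
  · simp [colors, colors_hang, hs.length_colors, ht.length_colors]
    omega

/-- Gluing `i + 1` separating trees along a caterpillar. -/
lemma exists_separating_caterpillar {n D E : ℕ} (hn : 0 < n)
    (h : ∀ b, ∃ t, Separating b n D E t) (b i : ℕ) :
    ∃ t, Separating b ((i + 1) * n) (D + 1) ((i + 1) * E + n * (i * (i + 2))) t := by
  induction i with
  | zero =>
    obtain ⟨t, ht⟩ := h b
    exact ⟨t, by simpa using ht.mono D.le_succ⟩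
  | succ i ih =>
    obtain ⟨s, hs⟩ := ih
    obtain ⟨t, ht⟩ := h (b + (i + 1) * n)
    have hE : (i + 1) * E + n * (i * (i + 2)) + E + n + 2 * ((i + 1) * n) =
        (i + 1 + 1) * E + n * ((i + 1) * (i + 1 + 2)) := by ring
    have hst := hs.glue ht (by positivity) hn
    rw [← Nat.succ_mul, hE] at hst
    exact ⟨_, hst⟩

lemma exists_separating {q : ℕ} (hq : 1 ≤ q) (Δ b : ℕ) :
    ∃ t, Separating b (q ^ Δ) Δ (Δ * (q ^ (Δ + 1) - q ^ (Δ - 1))) t := by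
  obtain ⟨p, rfl⟩ := Nat.exists_eq_add_of_le' hq
  have hE : ∀ k : ℕ, (p + 1) ^ (k + 2) - (p + 1) ^ k = (p + 1) ^ k * (p * (p + 2)) := by
    intro k
    rw [Nat.sub_eq_iff_eq_add (Nat.pow_le_pow_right hq (by omega))]
    ring
  induction Δ generalizing b with
  | zero => exact ⟨_, by simpa using separating_leaf b⟩
  | succ k ih =>
    obtain ⟨t, ht⟩ := exists_separating_caterpillar (by positivity) ih b p
    refine ⟨t, ?_⟩
    convert ht using 1
    · ring
    · rw [Nat.add_sub_cancel, hE]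
      cases k with
      | zero => simp
      | succ k =>
        rw [Nat.add_sub_cancel, hE]
        ring

end TreeTerm

open TreeTerm in
/-- for all `Δ ≥ 0` and `q ≥ 2` there is a rooted, partially edge-colored
tree such that: (a) for each leaf `v` there is a color `c_v` whose deletion leaves `v` as
the unique surviving leaf of minimal depth; (b) each color appears on at most `Δ` edges;
(c) there are exactly `q^Δ` leaves; (d) every leaf has depth between `q^Δ − 1` and
`2(q^Δ − 1)`; (e) there are exactly `Δ·(q^{Δ+1} − q^{Δ−1})` edges. -/
theorem exists_lower_bound_tree (Δ q : ℕ) (hq : 2 ≤ q) :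
    ∃ (C : Type) (T : RCTree C),
      (∀ v : T.V, T.IsLeaf v → ∃ c : C,
        T.Survives c v ∧
        ∀ v' : T.V, T.IsLeaf v' → v' ≠ v → T.Survives c v' → T.depth v < T.depth v') ∧
      (∀ c : C, {v : T.V | v ≠ T.root ∧ T.col v = some c}.ncard ≤ Δ) ∧
      {v : T.V | T.IsLeaf v}.ncard = q ^ Δ ∧
      (∀ v : T.V, T.IsLeaf v → q ^ Δ - 1 ≤ T.depth v ∧ T.depth v ≤ 2 * (q ^ Δ - 1)) ∧
      {v : T.V | v ≠ T.root}.ncard = Δ * (q ^ (Δ + 1) - q ^ (Δ - 1)) := by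
  obtain ⟨t, ht⟩ := exists_separating (one_le_two.trans hq) Δ 0
  have hpw := ht.pairwise
  rw [leafTraces, List.pairwise_map] at hpw
  have hmem : ∀ {v a}, (a, v) ∈ labelledLeaves t → (a, trace t v) ∈ leafTraces t :=
    fun h => List.mem_map_of_mem (f := fun x => (x.1, trace t x.2)) h
  refine ⟨ℕ, t.toRCTree, ?_, ?_, ?_, ?_, ?_⟩
  · intro v hv
    obtain ⟨a, ha⟩ := (isLeaf_iff ht.wellFormed v).1 hv
    refine ⟨a, (survives_iff t a v).2 (ht.label_notMem _ (hmem ha)), fun v' hv' hne hsurv => ?_⟩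
    obtain ⟨a', ha'⟩ := (isLeaf_iff ht.wellFormed v').1 hv'
    replace hsurv := (survives_iff t a v').1 hsurv
    let R : ℕ × Option (Node t) → ℕ × Option (Node t) → Prop := fun x y =>
      (trace t x.2).length < (trace t y.2).length ∧ some y.1 ∈ trace t x.2
    have hR : (labelledLeaves t).Pairwise fun x y => R x y ∨ R y x := hpw.imp Or.inl
    have : Std.Symm fun x y => R x y ∨ R y x := ⟨fun _ _ => Or.symm⟩
    rcases hR.forall ha ha' (fun h => hne (congrArg Prod.snd h).symm) with h | h
    · exact h.1
    · exact absurd h.2 hsurv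
  · intro c
    have h : {v : Option (Node t) | v ≠ none ∧ v.bind (color t) = some c} =
        some '' {x : Node t | color t x = some c} := by
      ext v
      cases v <;> simp
    change Set.ncard {v : Option (Node t) | v ≠ none ∧ v.bind (color t) = some c} ≤ Δ
    rw [h]
    refine (Set.ncard_image_of_injective _ (Option.some_injective _)).trans_le ?_
    rw [ncard_color_eq]
    exact ht.count_le c
  · classical
    have h : {v : Option (Node t) | t.toRCTree.IsLeaf v} =
        (((labelledLeaves t).map Prod.snd).toFinset : Set (Option (Node t))) := by
      ext v
      simp [isLeaf_iff ht.wellFormed]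
    have hnd : ((labelledLeaves t).map Prod.snd).Nodup :=
      List.pairwise_map.2 (hpw.imp fun h heq => by simp [heq] at h)
    change Set.ncard {v : Option (Node t) | t.toRCTree.IsLeaf v} = _
    rw [h, Set.ncard_coe_finset, List.toFinset_card_of_nodup hnd, List.length_map,
      ← ht.length_leafTraces, leafTraces, List.length_map]
  · intro v hv
    obtain ⟨a, ha⟩ := (isLeaf_iff ht.wellFormed v).1 hv
    have := ht.depth_mem _ (hmem ha)
    change _ ≤ (trace t v).length ∧ (trace t v).length ≤ _
    dsimp only at this
    omega
  · have h : {v : Option (Node t) | v ≠ none} = Set.range some := by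
      ext v
      exact Option.ne_none_iff_exists
    change Set.ncard {v : Option (Node t) | v ≠ none} = _
    rw [h, ← ht.length_colors, ← card_node, ← Set.image_univ,
      Set.ncard_image_of_injective _ (Option.some_injective _), Set.ncard_univ,
      Nat.card_eq_fintype_card]
end

section
/- Spanner stretch argument: Let G be an edge-colored unweighted undirected graph, c a color, and u, v vertices. Let H ⊆ G be a subgraph and S ⊆ V such that dist_H(w,z | c) = dist_G(w,z | c) for all w ∈ S ∪ V and z with (w,z) ∈ (S×V) ∪ (V×S). Suppose x is a vertex on some shortest u–v path in G−c, and there exists an edge (x,s) of G with s ∈ S whose color is not c. Then dist_H(u,v | c) ≤ dist_G(u,v | c) + 2. -/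
/-- `IsWalkFrom a l b`: the list of edges `l` forms a walk from `a` to `b`. -/
def IsWalkFrom {V : Type*} : V → List (V × V) → V → Prop
  | a, [], b => a = b
  | a, e :: l, b => e.1 = a ∧ IsWalkFrom e.2 l b

/-- Shortest-walk distance using only edges of `E` whose color is not `c`. -/
noncomputable def cWalkDist {V C : Type*} (E : Set (V × V)) (col : V × V → C) (c : C)
    (a b : V) : ℕ∞ :=
  sInf {n : ℕ∞ | ∃ l : List (V × V),
    IsWalkFrom a l b ∧ (∀ e ∈ l, e ∈ E ∧ col e ≠ c) ∧ n = (l.length : ℕ∞)}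

theorem IsWalkFrom.append {V : Type*} {a b d : V} {l m : List (V × V)}
    (hl : IsWalkFrom a l b) (hm : IsWalkFrom b m d) : IsWalkFrom a (l ++ m) d := by
  induction l generalizing a with
  | nil => cases hl; exact hm
  | cons e l ih => exact ⟨hl.1, ih hl.2⟩

theorem cWalkDist_le_one {V C : Type*} {E : Set (V × V)} {col : V × V → C} {c : C} {a b : V}
    (hE : (a, b) ∈ E) (hcol : col (a, b) ≠ c) : cWalkDist E col c a b ≤ 1 := by
  refine sInf_le ⟨[(a, b)], ⟨rfl, rfl⟩, ?_, by simp⟩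
  simpa using ⟨hE, hcol⟩

theorem exists_walk_of_cWalkDist_ne_top {V C : Type*} {E : Set (V × V)} {col : V × V → C} {c : C}
    {a b : V} (h : cWalkDist E col c a b ≠ ⊤) :
    ∃ l : List (V × V), IsWalkFrom a l b ∧ (∀ e ∈ l, e ∈ E ∧ col e ≠ c) ∧
      cWalkDist E col c a b = (l.length : ℕ∞) := by
  refine csInf_mem (s := {n : ℕ∞ | ∃ l : List (V × V),
    IsWalkFrom a l b ∧ (∀ e ∈ l, e ∈ E ∧ col e ≠ c) ∧ n = (l.length : ℕ∞)}) ?_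
  rw [Set.nonempty_iff_ne_empty]
  intro he
  exact h (by rw [cWalkDist, he, sInf_empty])

theorem cWalkDist_triangle {V C : Type*} (E : Set (V × V)) (col : V × V → C) (c : C)
    (a b d : V) : cWalkDist E col c a d ≤ cWalkDist E col c a b + cWalkDist E col c b d := by
  by_cases hab : cWalkDist E col c a b = ⊤
  · simp [hab]
  by_cases hbd : cWalkDist E col c b d = ⊤
  · simp [hbd]
  obtain ⟨l, hl, hlE, hl_len⟩ := exists_walk_of_cWalkDist_ne_top hab
  obtain ⟨m, hm, hmE, hm_len⟩ := exists_walk_of_cWalkDist_ne_top hbd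
  rw [hl_len, hm_len]
  refine sInf_le ⟨l ++ m, hl.append hm, ?_, by simp⟩
  intro e he
  exact (List.mem_append.mp he).elim (hlE e) (hmE e)

/-- spanner stretch argument: if `H ⊆ G` preserves all `S×V` and `V×S`
distances under the color fault `c`, `x` lies on a shortest `u`–`v` path of `G − c`, and
some non-`c`-colored edge joins `x` to `s ∈ S`, then
`dist_H(u,v | c) ≤ dist_G(u,v | c) + 2`. -/
theorem spanner_stretch {V C : Type*} (G H : Set (V × V)) (col : V × V → C) (c : C)
    (S : Set V) (u v x s : V)
    (hGsym : ∀ a b : V, (a, b) ∈ G → (b, a) ∈ G)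
    (hHsym : ∀ a b : V, (a, b) ∈ H → (b, a) ∈ H)
    (hcolsym : ∀ a b : V, col (a, b) = col (b, a))
    (hHG : H ⊆ G)
    (hpres : ∀ w z : V, w ∈ S ∨ z ∈ S → cWalkDist H col c w z = cWalkDist G col c w z)
    (hx : cWalkDist G col c u x + cWalkDist G col c x v = cWalkDist G col c u v)
    (hs : s ∈ S) (hedge : (x, s) ∈ G) (hcol : col (x, s) ≠ c) :
    cWalkDist H col c u v ≤ cWalkDist G col c u v + 2 := by
  calc
    cWalkDist H col c u v
      ≤ cWalkDist H col c u s + cWalkDist H col c s v := cWalkDist_triangle ..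
    _ = cWalkDist G col c u s + cWalkDist G col c s v := by
      rw [hpres u s (Or.inr hs), hpres s v (Or.inl hs)]
    _ ≤ (cWalkDist G col c u x + cWalkDist G col c x s) +
        (cWalkDist G col c s x + cWalkDist G col c x v) :=
      add_le_add (cWalkDist_triangle ..) (cWalkDist_triangle ..)
    _ ≤ (cWalkDist G col c u x + 1) + (1 + cWalkDist G col c x v) := by
      gcongr
      · exact cWalkDist_le_one hedge hcol
      · exact cWalkDist_le_one (hGsym x s hedge) (hcolsym x s ▸ hcol)
    _ = cWalkDist G col c u v + 2 := by
      rw [← hx]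
      ring
end
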